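/- Let (A, 𝔪) be a quasi-local commutative ring with identity 1 ≠ 0 (i.e., A has a unique maximal ideal 𝔪). Then every proper ideal of A is a weakly 1-absorbing prime ideal if and only if 𝔪³ = (0). -/

import Mathlib

/-- A proper ideal `P` is weakly 1-absorbing prime if whenever `0 ≠ x*y*z ∈ P` for
nonunits `x, y, z`, then `x*y ∈ P` or `z ∈ P`. -/
def IsWeakly1AbsorbingPrime {A : Type*} [CommRing A] (P : Ideal A) : Prop :=
  P ≠ ⊤ ∧ ∀ x y z : A, ¬IsUnit x → ¬IsUnit y → ¬IsUnit z →
    x * y * z ≠ 0 → x * y * z ∈ P → x * y ∈ P ∨ z ∈ P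

/-- A proper ideal `P` is weakly prime if whenever `0 ≠ x*y ∈ P`, then `x ∈ P` or `y ∈ P`. -/
def IsWeaklyPrime {A : Type*} [CommRing A] (P : Ideal A) : Prop :=
  P ≠ ⊤ ∧ ∀ x y : A, x * y ≠ 0 → x * y ∈ P → x ∈ P ∨ y ∈ P

/-- In a local ring, an element divisible by its own product with a nonunit is zero. -/
theorem IsLocalRing.eq_zero_of_mul_dvd {A : Type*} [CommRing A] [IsLocalRing A] {a z : A}
    (hz : ¬IsUnit z) (h : a * z ∣ a) : a = 0 := by
  obtain ⟨r, hr⟩ := h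
  have hu : IsUnit (1 - z * r) :=
    (IsLocalRing.isUnit_or_isUnit_one_sub_self (z * r)).resolve_left
      fun h => hz (isUnit_of_mul_isUnit_left h)
  exact (hu.mul_left_eq_zero).1 (by linear_combination hr)

theorem localRing_forall_isWeakly1AbsorbingPrime_iff {A : Type*} [CommRing A] [IsLocalRing A] :
    (∀ P : Ideal A, P ≠ ⊤ → IsWeakly1AbsorbingPrime P) ↔
      (IsLocalRing.maximalIdeal A) ^ 3 = ⊥ := by
  constructor
  · intro h
    rw [pow_three', eq_bot_iff]
    refine Ideal.mul_le.2 fun a ha z hz => ?_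
    revert a
    suffices IsLocalRing.maximalIdeal A * IsLocalRing.maximalIdeal A ≤
        LinearMap.ker (LinearMap.mulRight A z) from fun a ha => this ha
    refine Ideal.mul_le.2 fun x hx y hy => ?_
    rw [LinearMap.mem_ker, LinearMap.mulRight_apply]
    by_contra hne
    rw [IsLocalRing.mem_maximalIdeal, mem_nonunits_iff] at hx hy hz
    have hxy : ¬IsUnit (x * y) := fun hu => hx (isUnit_of_mul_isUnit_left hu)
    have hP : Ideal.span {x * y * z} ≠ ⊤ := fun ht =>
      hz (isUnit_of_mul_isUnit_right (Ideal.span_singleton_eq_top.1 ht))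
    rcases (h _ hP).2 x y z hx hy hz hne (Ideal.mem_span_singleton_self _) with hmem | hmem
    · have h0 := IsLocalRing.eq_zero_of_mul_dvd hz (Ideal.mem_span_singleton.1 hmem)
      exact hne (by rw [h0, zero_mul])
    · rw [Ideal.mem_span_singleton, mul_comm] at hmem
      exact hne (by rw [IsLocalRing.eq_zero_of_mul_dvd hxy hmem, mul_zero])
  · refine fun h P hP => ⟨hP, fun x y z hx hy hz hne _ => (hne ?_).elim⟩
    rw [← Ideal.mem_bot, ← h, pow_three']
    exact Ideal.mul_mem_mul (Ideal.mul_mem_mul hx hy) hz
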